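/- There is no monotone map w : □ × V → V satisfying all of the following: w((0,0),(i,j)) = (i,j) for all (i,j) ∈ V; w((1,1),(i,j)) = (i+1, j+1) for all (i,j) ∈ V; w((a,b),(i,i)) = (i+a, i+b) for every (a,b) ∈ □ and every i ∈ ℤ; and w((a,b),(i,j)) ∈ ∂V whenever i ≠ j. (In particular, Heller's asserted construction of a comparison functor w compatible with the untwisted shift s(i,j) = (i+1,j+1) cannot exist.) -/

import Mathlib

/-- The poset `V = {(i,j) ∈ ℤ × ℤ : |i - j| ≤ 1}`. -/
def Vset : Set (ℤ × ℤ) := {p | |p.1 - p.2| ≤ 1}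

/-- The boundary `∂V = {(i,j) ∈ V : |i - j| = 1}`. -/
def bVset : Set (ℤ × ℤ) := {p | |p.1 - p.2| = 1}

/-- The square poset `□ = {0,1} × {0,1}`, realized inside `ℤ × ℤ`. -/
def Square : Set (ℤ × ℤ) := {(0, 0), (0, 1), (1, 0), (1, 1)}

/-- There is no monotone map `w : □ × V → V` with `w((0,0),(i,j)) = (i,j)`,
`w((1,1),(i,j)) = (i+1,j+1)`, `w((a,b),(i,i)) = (i+a, i+b)` and
`w((a,b),(i,j)) ∈ ∂V` whenever `i ≠ j`: Heller's asserted comparison functor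
compatible with the untwisted shift `s(i,j) = (i+1,j+1)` cannot exist. -/
theorem no_untwisted_comparison_map :
    ¬ ∃ w : ℤ × ℤ → ℤ × ℤ → ℤ × ℤ,
      (∀ q ∈ Square, ∀ p ∈ Vset, w q p ∈ Vset) ∧
      (∀ q q' p p' : ℤ × ℤ, q ∈ Square → q' ∈ Square → p ∈ Vset → p' ∈ Vset →
        q ≤ q' → p ≤ p' → w q p ≤ w q' p') ∧
      (∀ p ∈ Vset, w (0, 0) p = p) ∧
      (∀ p ∈ Vset, w (1, 1) p = (p.1 + 1, p.2 + 1)) ∧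
      (∀ a b i : ℤ, (a, b) ∈ Square → w (a, b) (i, i) = (i + a, i + b)) ∧
      (∀ q ∈ Square, ∀ p ∈ Vset, p.1 ≠ p.2 → w q p ∈ bVset) := by
  rintro ⟨w, -, hmono, hzero, hone, hdiag, hbdry⟩
  have h00 : ((0, 0) : ℤ × ℤ) ∈ Square := by simp [Square]
  have h10 : ((1, 0) : ℤ × ℤ) ∈ Square := by simp [Square]
  have h11 : ((1, 1) : ℤ × ℤ) ∈ Square := by simp [Square]
  have v00 : ((0, 0) : ℤ × ℤ) ∈ Vset := by simp [Vset]
  have v01 : ((0, 1) : ℤ × ℤ) ∈ Vset := by simp [Vset]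
  have v11 : ((1, 1) : ℤ × ℤ) ∈ Vset := by simp [Vset]
  -- The value at `((1, 0), (0, 1))` is squeezed to the diagonal point `(1, 1)`.
  have l1 := hmono (0, 0) (1, 0) (0, 1) (0, 1) h00 h10 v01 v01 (by simp) le_rfl
  have l2 := hmono (1, 0) (1, 0) (0, 0) (0, 1) h10 h10 v00 v01 le_rfl (by simp)
  have u1 := hmono (1, 0) (1, 1) (0, 1) (0, 1) h10 h11 v01 v01 (by simp) le_rfl
  have u2 := hmono (1, 0) (1, 0) (0, 1) (1, 1) h10 h10 v01 v11 le_rfl (by simp)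
  rw [hzero _ v01] at l1
  rw [hdiag 1 0 0 h10] at l2
  rw [hone _ v01] at u1
  rw [hdiag 1 0 1 h10] at u2
  have hb : |(w (1, 0) (0, 1)).1 - (w (1, 0) (0, 1)).2| = 1 :=
    hbdry (1, 0) h10 (0, 1) v01 (by simp)
  simp only [Prod.le_def] at l1 l2 u1 u2
  have h1 : (w (1, 0) (0, 1)).1 = 1 := by omega
  have h2 : (w (1, 0) (0, 1)).2 = 1 := by omega
  simp [h1, h2] at hb
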